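/- Bailey's transformation of a terminating balanced very-well-poised ₁₀W₉: for n ∈ ℕ and nonzero complex numbers q, a, b, c, d, e, f with 0 < |q| < 1, setting λ := qa²/(bcd) and g := q^{n+2}a³/(bcdef), and assuming no factor in any denominator below vanishes, one has ∑_{k=0}^n ((1 − a q^{2k})/(1 − a)) · ((a;q)_k (b;q)_k (c;q)_k (d;q)_k (e;q)_k (f;q)_k (g;q)_k (q^{−n};q)_k) / ((q;q)_k (qa/b;q)_k (qa/c;q)_k (qa/d;q)_k (qa/e;q)_k (qa/f;q)_k (qa/g;q)_k (q^{n+1}a;q)_k) · q^k = ((qa;q)_n (qa/(ef);q)_n (qλ/e;q)_n (qλ/f;q)_n) / ((qa/e;q)_n (qa/f;q)_n (qλ/(ef);q)_n (qλ;q)_n) · ∑_{k=0}^n ((1 − λ q^{2k})/(1 − λ)) · ((λ;q)_k (qa/(cd);q)_k (qa/(bd);q)_k (qa/(bc);q)_k (e;q)_k (f;q)_k (g;q)_k (q^{−n};q)_k) / ((q;q)_k (bcd/a;q)_k (qλ a /(qa/c)… ) — explicitly, with lower parameters (qλ/(qa/(cd)), qλ/(qa/(bd)), qλ/(qa/(bc)),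 qλ/e, qλ/f, qλ/g, q^{n+1}λ) — · q^k; i.e. ₁₀W₉(a; b,c,d,e,f,g,q^{−n};q,q) = [((qa;q)_n (qa/(ef);q)_n ((qa)²/(bcde);q)_n ((qa)²/(bcdf);q)_n) / ((qa/e;q)_n (qa/f;q)_n ((qa)²/(bcdef);q)_n ((qa)²/(bcd);q)_n)] · ₁₀W₉(qa²/(bcd); qa/(cd), qa/(bd), qa/(bc), e, f, g, q^{−n}; q, q). -/

import Mathlib

/-- The finite `q`-shifted factorial `(a;q)_k`. -/
noncomputable def qPoch (a q : ℂ) (k : ℕ) : ℂ := ∏ j ∈ Finset.range k, (1 - a * q ^ j)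

theorem qPoch_zero (a q : ℂ) : qPoch a q 0 = 1 := by simp [qPoch]

theorem qPoch_succ (a q : ℂ) (k : ℕ) : qPoch a q (k + 1) = qPoch a q k * (1 - a * q ^ k) := by
  simp [qPoch, Finset.prod_range_succ]

theorem qPoch_add (a q : ℂ) (m n : ℕ) :
    qPoch a q (m + n) = qPoch a q m * qPoch (a * q ^ m) q n := by
  simp only [qPoch, Finset.prod_range_add, pow_add, mul_assoc]

theorem qPoch_ne_zero_of_le {a q : ℂ} {m n : ℕ} (hmn : m ≤ n) (h : qPoch a q n ≠ 0) :
    qPoch a q m ≠ 0 := by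
  obtain ⟨k, rfl⟩ := Nat.exists_eq_add_of_le hmn
  rw [qPoch_add] at h
  exact left_ne_zero_of_mul h

theorem qPoch_shift_ne_zero {a q : ℂ} {m n k : ℕ} (hmn : m + k ≤ n) (h : qPoch a q n ≠ 0) :
    qPoch (a * q ^ m) q k ≠ 0 := by
  have := qPoch_ne_zero_of_le hmn h
  rw [qPoch_add] at this
  exact right_ne_zero_of_mul this

theorem one_sub_ne_zero_of_qPoch {a q : ℂ} {m n : ℕ} (hmn : m < n) (h : qPoch a q n ≠ 0) :
    1 - a * q ^ m ≠ 0 := by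
  have := qPoch_ne_zero_of_le (Nat.succ_le_of_lt hmn) h
  rw [Nat.succ_eq_add_one, qPoch_succ] at this
  exact right_ne_zero_of_mul this

theorem qPoch_self_ne_zero {q : ℂ} (hq1 : ‖q‖ < 1) (k : ℕ) : qPoch q q k ≠ 0 := by
  rw [qPoch, Finset.prod_ne_zero_iff]
  intro j _ h
  have h2 : ‖q ^ (j + 1)‖ < 1 := by
    rw [norm_pow]; exact pow_lt_one₀ (norm_nonneg _) hq1 (by omega)
  rw [pow_succ', ← sub_eq_zero.mp h] at h2
  simp at h2

/-- Summand of Jackson's terminating `₈W₇` sum with `n = m + k`, normalised so that no factor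
depends on `n` alone. -/
noncomputable def jacksonTerm (A B C D X q : ℂ) (m k : ℕ) : ℂ :=
  (1 - A * q ^ (2 * k)) * (qPoch A q k * qPoch B q k * qPoch C q k * qPoch D q k *
    qPoch (A * X) q (m + 2 * k) * qPoch X q m * X ^ k) /
    (qPoch q q k * qPoch (C * D * X) q k * qPoch (B * D * X) q k * qPoch (B * C * X) q k *
      qPoch q q m * qPoch A q (m + 2 * k + 1))

theorem jackson_certificate_initial {A B C D X q : ℂ} (hA : A * q = B * C * D * X) (p : ℂ) :
    (1 - X * p) * ((1 - C * D * X * p) * (1 - B * D * X * p) * (1 - B * C * X * p)) -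
      (1 - D * X * p) * (1 - B * X * p) * (1 - C * X * p) * (1 - A * (p * q)) =
    -((1 - A * X * (p ^ 2 * q)) * p) * (X * (1 - B) * (1 - C) * (1 - D)) := by
  have h1 : A * (p * q) = B * C * D * X * p := by linear_combination p * hA
  have h2 : A * X * (p ^ 2 * q) = B * C * D * X ^ 2 * p ^ 2 := by
    linear_combination X * p ^ 2 * hA
  rw [h1, h2]
  ring

theorem jackson_certificate_step {A B C D X q : ℂ} (hA : A * q = B * C * D * X) (R p : ℂ) :
    (1 - A * (R * q) ^ 2) *
      ((1 - A * X * ((R * q) ^ 2 * p)) * (1 - X * p) *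
        ((1 - R * q * p * q) * (1 - C * D * X * (R * q * p)) * (1 - B * D * X * (R * q * p)) *
          (1 - B * C * X * (R * q * p))) -
        (1 - A * X * (R * q * p)) * (1 - D * X * (R * q * p)) * (1 - B * X * (R * q * p)) *
          (1 - C * X * (R * q * p)) * (1 - q * p) * (1 - A * ((R * q) ^ 2 * p * q))) -
      (1 - A * X * ((R * q * p) ^ 2 * q)) * (p * q) * (1 - X * p) *
        (1 - A * ((R * q) ^ 2 * p * q)) *
        ((1 - q * R) * (1 - C * D * X * R) * (1 - B * D * X * R) * (1 - B * C * X * R)) =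
    -((1 - A * X * ((R * q * p) ^ 2 * q)) * p) * X * ((1 - A * (R * q)) * (1 - B * (R * q)) *
      (1 - C * (R * q)) * (1 - D * (R * q))) * (1 - A * X * ((R * q) ^ 2 * p)) *
        (1 - q * p) := by
  have h1 (z : ℂ) : A * (z * q) = B * C * D * X * z := by linear_combination z * hA
  have h2 (z : ℂ) : A * X * (z * q) = B * C * D * X ^ 2 * z := by linear_combination X * z * hA
  have e1 : A * (R * q) ^ 2 = B * C * D * X * (R ^ 2 * q) := by rw [← h1]; ring
  have e2 : A * X * ((R * q) ^ 2 * p) = B * C * D * X ^ 2 * (R ^ 2 * q * p) := by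
    rw [← h2]; ring
  have e3 : A * X * (R * q * p) = B * C * D * X ^ 2 * (R * p) := by rw [← h2]; ring
  rw [e1, e2, e3, h1, h1, h2]
  ring

theorem div_add_div_eq_of_certificate {U V Y Z z₁ z₃ x₁ x₂ x₃ x₈ p q X F G : ℂ}
    (hV : V ≠ 0) (hY : Y ≠ 0) (hZ : Z ≠ 0) (hz₁ : z₁ ≠ 0) (hz₃ : z₃ ≠ 0)
    (h : x₁ * (x₂ * x₃ * Y - F * z₃ * z₁) - x₈ * (p * q) * x₃ * z₁ * Z =
      -(x₈ * p) * X * G * x₂ * z₃) :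
    -(x₈ * (p * q)) / Y * (U * x₃ / (V * z₃)) +
      (x₁ * (U * x₂ * x₃) / (V * Z * z₃ * z₁) - F / Y * (x₁ * U / (V * Z))) =
    -(x₈ * p) / Y * (U * G * x₂ * X / (V * Z * z₁)) := by
  field_simp
  linear_combination U * h

theorem jacksonTerm_telescope {A B C D X q : ℂ} (hA : A * q = B * C * D * X)
    (hq : ∀ k, qPoch q q k ≠ 0) (N : ℕ) (hAN : qPoch A q (2 * N + 3) ≠ 0)
    (hCD : qPoch (C * D * X) q (N + 1) ≠ 0) (hBD : qPoch (B * D * X) q (N + 1) ≠ 0)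
    (hBC : qPoch (B * C * X) q (N + 1) ≠ 0) (k m : ℕ) (hN : N = k + m) :
    ∑ i ∈ Finset.range (k + 1), (jacksonTerm A B C D X q (N + 1 - i) i -
      (1 - A * X * q ^ N) * (1 - D * X * q ^ N) * (1 - B * X * q ^ N) * (1 - C * X * q ^ N) /
        ((1 - q ^ (N + 1)) * (1 - C * D * X * q ^ N) * (1 - B * D * X * q ^ N) *
          (1 - B * C * X * q ^ N)) * jacksonTerm A B C D X q (N - i) i) =
      -((1 - A * X * q ^ (2 * N + 1)) * q ^ m) /
        ((1 - q ^ (N + 1)) * (1 - C * D * X * q ^ N) * (1 - B * D * X * q ^ N) *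
          (1 - B * C * X * q ^ N)) *
      (qPoch A q (k + 1) * qPoch B q (k + 1) * qPoch C q (k + 1) * qPoch D q (k + 1) *
        qPoch (A * X) q (2 * k + m + 1) * qPoch X q m * X ^ (k + 1) /
        (qPoch q q k * qPoch (C * D * X) q k * qPoch (B * D * X) q k * qPoch (B * C * X) q k *
          qPoch q q m * qPoch A q (2 * k + m + 2))) := by
  have e1 : 1 - q ^ (N + 1) ≠ 0 := by
    have := one_sub_ne_zero_of_qPoch (Nat.lt_succ_self N) (hq _)
    rwa [← pow_succ'] at this
  have e2 := one_sub_ne_zero_of_qPoch (Nat.lt_succ_self N) hCD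
  have e3 := one_sub_ne_zero_of_qPoch (Nat.lt_succ_self N) hBD
  have e4 := one_sub_ne_zero_of_qPoch (Nat.lt_succ_self N) hBC
  induction k generalizing m with
  | zero =>
    obtain rfl : N = m := by omega
    have a1 := hq N
    have a2 := one_sub_ne_zero_of_qPoch (Nat.lt_succ_self N) (hq _)
    have a3 := qPoch_ne_zero_of_le (m := N) (by omega) hAN
    have a4 := one_sub_ne_zero_of_qPoch (m := N) (by omega) hAN
    have a5 := one_sub_ne_zero_of_qPoch (m := N + 1) (by omega) hAN
    have key := jackson_certificate_initial hA (q ^ N)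
    simp only [jacksonTerm, zero_add, Finset.sum_range_one, qPoch_zero, qPoch_succ, mul_zero,
      add_zero, Nat.sub_zero, pow_zero, pow_one, mul_one, one_mul] at *
    have a6 : 1 - q ^ N * q ≠ 0 := by rwa [mul_comm]
    rw [show q ^ (2 * N + 1) = (q ^ N) ^ 2 * q by ring]
    simp only [pow_succ q N] at *
    generalize qPoch (A * X) q N = v at *
    generalize qPoch A q N = u at *
    generalize qPoch X q N = x at *
    generalize qPoch q q N = w at *
    generalize q ^ N = p at *
    rw [mul_comm q p]
    clear hAN hCD hBD hBC a2
    generalize 1 - C * D * X * p = y2 at *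
    generalize 1 - B * D * X * p = y3 at *
    generalize 1 - B * C * X * p = y4 at *
    generalize 1 - A * (p * q) = y5 at *
    generalize 1 - A * X * (p ^ 2 * q) = y6 at *
    generalize 1 - A * p = y7 at *
    generalize 1 - p * q = y1 at *
    field_simp
    linear_combination (1 - A) * v * (1 - A * X * p) * x * key
  | succ k ih =>
    obtain rfl : N = k + 1 + m := by omega
    rw [Finset.sum_range_succ, ih (m + 1) (by omega)]
    have key := jackson_certificate_step hA (q ^ k) (q ^ m)
    have n1 : k + 1 + m + 1 - (k + 1) = m + 1 := by omega
    have n2 : k + 1 + m - (k + 1) = m := by omega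
    rw [n1, n2]
    have a1 := hq k
    have a2 := one_sub_ne_zero_of_qPoch (Nat.lt_succ_self k) (hq _)
    have b1 := hq m
    have b2 := one_sub_ne_zero_of_qPoch (Nat.lt_succ_self m) (hq _)
    have a3 := qPoch_ne_zero_of_le (m := 2 * k + m + 3) (by omega) hAN
    have a4 := one_sub_ne_zero_of_qPoch (m := 2 * k + m + 3) (by omega) hAN
    have c1 := qPoch_ne_zero_of_le (m := k) (by omega) hCD
    have c2 := one_sub_ne_zero_of_qPoch (m := k) (by omega) hCD
    have d1 := qPoch_ne_zero_of_le (m := k) (by omega) hBD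
    have d2 := one_sub_ne_zero_of_qPoch (m := k) (by omega) hBD
    have f1 := qPoch_ne_zero_of_le (m := k) (by omega) hBC
    have f2 := one_sub_ne_zero_of_qPoch (m := k) (by omega) hBC
    simp only [jacksonTerm,
      show m + 1 + 2 * (k + 1) = 2 * k + m + 2 + 1 by ring,
      show m + 2 * (k + 1) = 2 * k + m + 2 by ring,
      show 2 * k + (m + 1) + 1 = 2 * k + m + 2 by ring,
      show 2 * k + (m + 1) + 2 = 2 * k + m + 3 by ring,
      show 2 * (k + 1) + m + 1 = 2 * k + m + 2 + 1 by ring,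
      show 2 * (k + 1) + m + 2 = 2 * k + m + 3 + 1 by ring,
      show 2 * k + m + 2 + 1 + 1 = 2 * k + m + 3 + 1 by ring,
      qPoch_succ (A * X) q (2 * k + m + 2), qPoch_succ A q (2 * k + m + 3),
      qPoch_succ _ _ k, qPoch_succ _ _ (k + 1), qPoch_succ _ _ m]
    simp only [show 2 * k + m + 2 + 1 = 2 * k + m + 3 by ring]
    have p1 : q ^ (2 * k + m + 2) = (q ^ k * q) ^ 2 * q ^ m := by ring
    have p2 : q ^ (2 * k + m + 3) = (q ^ k * q) ^ 2 * q ^ m * q := by ring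
    have p3 : q ^ (k + 1 + m) = q ^ k * q * q ^ m := by ring
    have p4 : q ^ (k + 1 + m + 1) = q ^ k * q * q ^ m * q := by ring
    have p5 : q ^ (2 * (k + 1 + m) + 1) = (q ^ k * q * q ^ m) ^ 2 * q := by ring
    have p6 : q ^ (2 * (k + 1)) = (q ^ k * q) ^ 2 := by ring
    rw [p4] at e1
    rw [p3] at e2 e3 e4
    rw [p2] at a4
    rw [p1, p2, p3, p4, p5, p6]
    simp only [pow_succ q, pow_succ X]
    clear ih n1 n2 hAN hCD hBD hBC p1 p2 p3 p4 p5 p6 hq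
    generalize qPoch (A * X) q (2 * k + m + 2) = v at *
    generalize qPoch A q (2 * k + m + 3) = u at *
    generalize qPoch A q k = uA at *
    generalize qPoch B q k = uB at *
    generalize qPoch C q k = uC at *
    generalize qPoch D q k = uD at *
    generalize qPoch (C * D * X) q k = vB at *
    generalize qPoch (B * D * X) q k = vC at *
    generalize qPoch (B * C * X) q k = vD at *
    generalize qPoch X q m = x at *
    generalize qPoch q q m = w at *
    generalize qPoch q q k = w' at *
    generalize q ^ k = R at *
    generalize q ^ m = p at *
    generalize X ^ k = Xk at *
    generalize 1 - A * ((R * q) ^ 2 * p * q) = z1 at *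
    generalize 1 - q * R = z2 at *
    generalize 1 - q * p = z3 at *
    generalize 1 - C * D * X * R = z4 at *
    generalize 1 - B * D * X * R = z5 at *
    generalize 1 - B * C * X * R = z6 at *
    generalize 1 - R * q * p * q = y1 at *
    generalize 1 - C * D * X * (R * q * p) = y2 at *
    generalize 1 - B * D * X * (R * q * p) = y3 at *
    generalize 1 - B * C * X * (R * q * p) = y4 at *
    generalize 1 - A * (R * q) ^ 2 = x1 at *
    generalize 1 - A * X * ((R * q) ^ 2 * p) = x2 at *
    generalize 1 - X * p = x3 at *
    generalize 1 - A * X * (R * q * p) = x4 at *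
    generalize 1 - D * X * (R * q * p) = x5 at *
    generalize 1 - B * X * (R * q * p) = x6 at *
    generalize 1 - C * X * (R * q * p) = x7 at *
    generalize 1 - A * X * ((R * q * p) ^ 2 * q) = x8 at *
    have := div_add_div_eq_of_certificate
      (U := uA * (1 - A * R) * (uB * (1 - B * R)) * (uC * (1 - C * R)) * (uD * (1 - D * R)) *
        v * x * (Xk * X)) (V := w' * vB * vC * vD * w * u) (Y := y1 * y2 * y3 * y4)
      (Z := z2 * z4 * z5 * z6) (by simp [*]) (by simp [*]) (by simp [*]) a4 b2
      (F := x4 * x5 * x6 * x7) key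
    linear_combination this

theorem sum_jacksonTerm {A B C D X q : ℂ} (hA : A * q = B * C * D * X)
    (hq : ∀ k, qPoch q q k ≠ 0) (N : ℕ) (hAN : qPoch A q (2 * N + 1) ≠ 0)
    (hCD : qPoch (C * D * X) q N ≠ 0) (hBD : qPoch (B * D * X) q N ≠ 0)
    (hBC : qPoch (B * C * X) q N ≠ 0) :
    ∑ k ∈ Finset.range (N + 1), jacksonTerm A B C D X q (N - k) k =
      qPoch (A * X) q N * qPoch (D * X) q N * qPoch (B * X) q N * qPoch (C * X) q N /
        (qPoch q q N * qPoch (C * D * X) q N * qPoch (B * D * X) q N *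
          qPoch (B * C * X) q N) := by
  induction N with
  | zero =>
    have : 1 - A ≠ 0 := by simpa [qPoch] using hAN
    simp [jacksonTerm, qPoch, this]
  | succ N ih =>
    have tel := jacksonTerm_telescope hA hq N hAN hCD hBD hBC N 0 rfl
    rw [Finset.sum_sub_distrib, ← Finset.mul_sum,
      ih (qPoch_ne_zero_of_le (by omega) hAN) (qPoch_ne_zero_of_le (by omega) hCD)
        (qPoch_ne_zero_of_le (by omega) hBD) (qPoch_ne_zero_of_le (by omega) hBC),
      sub_eq_iff_eq_add] at tel
    rw [Finset.sum_range_succ, tel]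
    have h1 := hq (N + 1)
    have h2 : qPoch A q (2 * N + 2 + 1) ≠ 0 := hAN
    simp only [jacksonTerm, Nat.sub_self, zero_add, add_zero, qPoch_zero, pow_zero, mul_one,
      show 2 * (N + 1) = 2 * N + 1 + 1 by ring, show 2 * N + 1 + 1 + 1 = 2 * N + 2 + 1 by ring,
      qPoch_succ (A * X) q (2 * N + 1), qPoch_succ A q (2 * N + 2)]
    simp only [show 2 * N + 1 + 1 = 2 * N + 2 by ring]
    simp only [qPoch_succ _ _ N] at *
    rw [qPoch_succ] at h2
    rw [← pow_succ'] at *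
    generalize qPoch A q (2 * N + 2) = w at *
    generalize qPoch (A * X) q (2 * N + 1) = w' at *
    generalize 1 - A * q ^ (2 * N + 2) = x1 at *
    generalize 1 - q ^ (N + 1) = x2 at *
    generalize 1 - C * D * X * q ^ N = x3 at *
    generalize 1 - B * D * X * q ^ N = x4 at *
    generalize 1 - B * C * X * q ^ N = x5 at *
    generalize qPoch q q N = y2 at *
    generalize qPoch (C * D * X) q N = y3 at *
    generalize qPoch (B * D * X) q N = y4 at *
    generalize qPoch (B * C * X) q N = y5 at *
    simp only [ne_eq, mul_eq_zero, not_or] at *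
    clear tel ih hq
    obtain ⟨_, _⟩ := h1
    obtain ⟨_, _⟩ := h2
    obtain ⟨_, _⟩ := hCD
    obtain ⟨_, _⟩ := hBD
    obtain ⟨_, _⟩ := hBC
    field_simp
    ring

theorem jackson_sum_of_generic {A B C D X q : ℂ} (hA : A * q = B * C * D * X)
    (hq : ∀ k, qPoch q q k ≠ 0) (N : ℕ) (hAN : qPoch A q (2 * N + 1) ≠ 0)
    (hAX : qPoch (A * X) q N ≠ 0)
    (hCD : qPoch (C * D * X) q N ≠ 0) (hBD : qPoch (B * D * X) q N ≠ 0)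
    (hBC : qPoch (B * C * X) q N ≠ 0) :
    ∑ k ∈ Finset.range (N + 1), (1 - A * q ^ (2 * k)) *
        (qPoch A q k * qPoch B q k * qPoch C q k * qPoch D q k * qPoch (A * X * q ^ N) q k *
          qPoch X q (N - k) * X ^ k) /
        (qPoch q q k * qPoch (C * D * X) q k * qPoch (B * D * X) q k * qPoch (B * C * X) q k *
          qPoch q q (N - k) * qPoch (A * q ^ (N + 1)) q k) =
      qPoch A q (N + 1) * qPoch (D * X) q N * qPoch (B * X) q N * qPoch (C * X) q N /
        (qPoch q q N * qPoch (C * D * X) q N * qPoch (B * D * X) q N *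
          qPoch (B * C * X) q N) := by
  have h := sum_jacksonTerm hA hq N hAN hCD hBD hBC
  have hA1 : qPoch A q (N + 1) ≠ 0 := qPoch_ne_zero_of_le (by omega) hAN
  have e : ∀ k ∈ Finset.range (N + 1), jacksonTerm A B C D X q (N - k) k =
      qPoch (A * X) q N / qPoch A q (N + 1) * ((1 - A * q ^ (2 * k)) *
        (qPoch A q k * qPoch B q k * qPoch C q k * qPoch D q k * qPoch (A * X * q ^ N) q k *
          qPoch X q (N - k) * X ^ k) /
        (qPoch q q k * qPoch (C * D * X) q k * qPoch (B * D * X) q k * qPoch (B * C * X) q k *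
          qPoch q q (N - k) * qPoch (A * q ^ (N + 1)) q k)) := by
    intro k hk
    have hk' : k ≤ N := Nat.lt_succ_iff.mp (Finset.mem_range.mp hk)
    rw [jacksonTerm, show N - k + 2 * k = N + k by omega, show N + k + 1 = N + 1 + k by omega,
      qPoch_add _ _ N k, qPoch_add _ _ (N + 1) k, div_mul_div_comm]
    congr 1 <;> ring
  rw [Finset.sum_congr rfl e, ← Finset.mul_sum, div_mul_eq_mul_div, div_eq_iff hA1] at h
  apply mul_left_cancel₀ hAX
  rw [h]
  ring

theorem continuous_qPoch (q : ℂ) (k : ℕ) : Continuous fun a => qPoch a q k := by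
  unfold qPoch
  fun_prop

theorem eventually_qPoch_mul_ne_zero {q c : ℂ} (hq0 : q ≠ 0) (hc : c ≠ 0) (z₀ : ℂ) (M : ℕ) :
    ∀ᶠ z in nhdsWithin z₀ {z₀}ᶜ, qPoch (z * c) q M ≠ 0 := by
  simp only [qPoch, Finset.prod_ne_zero_iff]
  rw [Filter.eventually_all_finset]
  intro j _
  have hr : c * q ^ j ≠ 0 := mul_ne_zero hc (pow_ne_zero j hq0)
  have h : ∀ᶠ z in nhdsWithin z₀ {z₀}ᶜ, z ≠ (c * q ^ j)⁻¹ := by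
    by_cases hz : z₀ = (c * q ^ j)⁻¹
    · filter_upwards [self_mem_nhdsWithin] with z h1
      exact hz ▸ h1
    · exact (eventually_ne_nhds hz).filter_mono nhdsWithin_le_nhds
  filter_upwards [h] with z h1 h2
  refine h1 (eq_inv_of_mul_eq_one_left ?_)
  linear_combination -h2

theorem jackson_sum {A B C D X q : ℂ} (hA : A * q = B * C * D * X) (hq0 : q ≠ 0)
    (hq : ∀ k, qPoch q q k ≠ 0) (hC : C ≠ 0) (hD : D ≠ 0) (hX : X ≠ 0) (N : ℕ)
    (hAN : qPoch (A * q ^ (N + 1)) q N ≠ 0)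
    (hCD : qPoch (C * D * X) q N ≠ 0) (hBD : qPoch (B * D * X) q N ≠ 0)
    (hBC : qPoch (B * C * X) q N ≠ 0) :
    ∑ k ∈ Finset.range (N + 1), (1 - A * q ^ (2 * k)) *
        (qPoch A q k * qPoch B q k * qPoch C q k * qPoch D q k * qPoch (A * X * q ^ N) q k *
          qPoch X q (N - k) * X ^ k) /
        (qPoch q q k * qPoch (C * D * X) q k * qPoch (B * D * X) q k * qPoch (B * C * X) q k *
          qPoch q q (N - k) * qPoch (A * q ^ (N + 1)) q k) =
      qPoch A q (N + 1) * qPoch (D * X) q N * qPoch (B * X) q N * qPoch (C * X) q N /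
        (qPoch q q N * qPoch (C * D * X) q N * qPoch (B * D * X) q N *
          qPoch (B * C * X) q N) := by
  obtain ⟨α, hα, hα', rfl⟩ : ∃ α, α ≠ 0 ∧ α * q = C * D * X ∧ A = B * α := by
    refine ⟨C * D * X / q, by positivity, by field_simp, ?_⟩
    field_simp
    linear_combination hA
  have cont {φ : ℂ → ℂ} (k : ℕ) (hφ : Continuous φ) : Continuous fun z => qPoch (φ z) q k :=
    (continuous_qPoch q k).comp hφ
  have ev {φ : ℂ → ℂ} (k : ℕ) (hφ : Continuous φ) (h : qPoch (φ B) q k ≠ 0) :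
      ∀ᶠ z in nhdsWithin B {B}ᶜ, qPoch (φ z) q k ≠ 0 :=
    ((cont k hφ).continuousAt.eventually_ne h).filter_mono nhdsWithin_le_nhds
  let L (z : ℂ) : ℂ := ∑ k ∈ Finset.range (N + 1), (1 - z * α * q ^ (2 * k)) *
        (qPoch (z * α) q k * qPoch z q k * qPoch C q k * qPoch D q k *
          qPoch (z * α * X * q ^ N) q k * qPoch X q (N - k) * X ^ k) /
        (qPoch q q k * qPoch (C * D * X) q k * qPoch (z * D * X) q k * qPoch (z * C * X) q k *
          qPoch q q (N - k) * qPoch (z * α * q ^ (N + 1)) q k)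
  let R (z : ℂ) : ℂ :=
    qPoch (z * α) q (N + 1) * qPoch (D * X) q N * qPoch (z * X) q N * qPoch (C * X) q N /
        (qPoch q q N * qPoch (C * D * X) q N * qPoch (z * D * X) q N * qPoch (z * C * X) q N)
  have hL : ContinuousAt L B := by
    refine tendsto_finsetSum _ fun k hk => ContinuousAt.div ?_ ?_ ?_
    · exact Continuous.continuousAt (by fun_prop (disch := assumption))
    · fun_prop
    · have hk' : k ≤ N := Nat.lt_succ_iff.mp (Finset.mem_range.mp hk)
      simp [hq, qPoch_ne_zero_of_le hk' hCD, qPoch_ne_zero_of_le hk' hBD,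
        qPoch_ne_zero_of_le hk' hBC, qPoch_ne_zero_of_le hk' hAN]
  have hR : ContinuousAt R B := by
    refine ContinuousAt.div ?_ ?_ ?_
    · fun_prop
    · fun_prop
    · simp [hq, hCD, hBD, hBC]
  have hLR : ∀ᶠ z in nhdsWithin B {B}ᶜ, L z = R z := by
    filter_upwards [ev (φ := fun z => z * D * X) N (by fun_prop) hBD,
      ev (φ := fun z => z * C * X) N (by fun_prop) hBC,
      eventually_qPoch_mul_ne_zero hq0 hα B (2 * N + 1),
      eventually_qPoch_mul_ne_zero hq0 (mul_ne_zero hα hX) B N] with z h1 h2 h3 h4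
    rw [← mul_assoc] at h4
    exact jackson_sum_of_generic (by linear_combination z * hα') hq N h3 h4 hCD h1 h2
  exact tendsto_nhds_unique_of_eventuallyEq (hL.tendsto.mono_left nhdsWithin_le_nhds)
    (hR.tendsto.mono_left nhdsWithin_le_nhds) hLR

theorem qPoch_reflect_ratio {q X₁ X₂ Y₁ Y₂ : ℂ} (hq0 : q ≠ 0) (r m : ℕ)
    (h₁ : Y₁ * X₁ * q ^ (m + r) = q) (h₂ : Y₂ * X₂ * q ^ (m + r) = q) :
    qPoch Y₁ q r * qPoch X₁ q m * qPoch X₂ q (m + r) * X₁ ^ r =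
      qPoch Y₂ q r * qPoch X₂ q m * qPoch X₁ q (m + r) * X₂ ^ r := by
  induction r generalizing m with
  | zero => simp [qPoch_zero, mul_comm]
  | succ r ih =>
    rw [show m + (r + 1) = m + 1 + r by ring] at *
    have ih' := ih (m + 1) h₁ h₂
    have e₁ : Y₁ * q ^ r * (X₁ * q ^ m) = 1 := by
      apply mul_left_cancel₀ hq0
      linear_combination h₁
    have e₂ : Y₂ * q ^ r * (X₂ * q ^ m) = 1 := by
      apply mul_left_cancel₀ hq0
      linear_combination h₂
    simp only [qPoch_succ _ _ r, qPoch_succ X₁ _ m, qPoch_succ X₂ _ m, pow_succ] at ih' ⊢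
    apply mul_left_cancel₀ (pow_ne_zero m hq0)
    linear_combination -ih' - qPoch Y₁ q r * qPoch X₁ q m * qPoch X₂ q (m + 1 + r) * X₁ ^ r * e₁
      + qPoch Y₂ q r * qPoch X₂ q m * qPoch X₁ q (m + 1 + r) * X₂ ^ r * e₂

theorem jackson_sum_shifted {q a l e f g : ℂ} (hq0 : q ≠ 0) (hq : ∀ k, qPoch q q k ≠ 0)
    (ha : a ≠ 0) (hl : l ≠ 0) (he : e ≠ 0) (hf : f ≠ 0) (j N : ℕ)
    (hg : g * (e * f) = l * a * q ^ (j + N + 1))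
    (h4 : qPoch (q * a / e) q (j + N) ≠ 0)
    (h5 : qPoch (q * a / f) q (j + N) ≠ 0) (h6 : qPoch (q * a / g) q (j + N) ≠ 0)
    (h7 : qPoch (q ^ (j + N + 1) * a) q (j + N) ≠ 0)
    (h11 : qPoch (q * l / e) q (j + N) ≠ 0) (h12 : qPoch (q * l / f) q (j + N) ≠ 0)
    (h13 : qPoch (q * l / g) q (j + N) ≠ 0)
    (h14 : qPoch (q ^ (j + N + 1) * l) q (j + N) ≠ 0)
    (h15 : qPoch (q * l / (e * f)) q (j + N) ≠ 0) (h16 : qPoch l q (j + N + 1) ≠ 0) :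
    ∑ r ∈ Finset.range (N + 1), (1 - a * q ^ (2 * (j + r))) *
        (qPoch a q (2 * j + r) * qPoch e q (j + r) * qPoch f q (j + r) * qPoch g q (j + r) *
          qPoch (q ^ (-((j + N : ℕ) : ℤ))) q (j + r) * q ^ (j + r) * qPoch (a / l) q r) /
        (qPoch (q * a / e) q (j + r) * qPoch (q * a / f) q (j + r) * qPoch (q * a / g) q (j + r) *
          qPoch (q ^ (j + N + 1) * a) q (j + r) * qPoch q q r * qPoch l q (2 * j + r + 1)) =
      qPoch a q (j + N + 1) * qPoch (q * a / (e * f)) q (j + N) * qPoch (q * l / e) q (j + N) *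
          qPoch (q * l / f) q (j + N) /
        (qPoch (q * a / e) q (j + N) * qPoch (q * a / f) q (j + N) *
          qPoch (q * l / (e * f)) q (j + N) * qPoch l q (j + N + 1)) *
      (qPoch e q j * qPoch f q j * qPoch g q j * qPoch (q ^ (-((j + N : ℕ) : ℤ))) q j * q ^ j *
          (l / a) ^ j /
        (qPoch (q * l / e) q j * qPoch (q * l / f) q j * qPoch (q * l / g) q j *
          qPoch (q ^ (j + N + 1) * l) q j)) := by
  have hg0 : g ≠ 0 := by
    intro h
    rw [h, zero_mul] at hg
    exact (mul_ne_zero (mul_ne_zero hl ha) (pow_ne_zero _ hq0)) hg.symm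
  have hqj := pow_ne_zero j hq0
  have hqN := pow_ne_zero N hq0
  have hh : q ^ (-((j + N : ℕ) : ℤ)) * (q ^ j * q ^ N) = 1 := by
    rw [← pow_add, zpow_neg, zpow_natCast, inv_mul_cancel₀ (pow_ne_zero _ hq0)]
  generalize q ^ (-((j + N : ℕ) : ℤ)) = h at *
  have hg' : g * (e * f) = l * a * (q ^ j * q ^ N * q) := by rw [hg]; ring
  have i1 : e * q ^ j * (f * q ^ j) * (q * l / (e * f)) = l * q ^ (2 * j + 1) := by
    field_simp; ring
  have i2 : a / l * (f * q ^ j) * (q * l / (e * f)) = q * a / e * q ^ j := by field_simp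
  have i3 : a / l * (e * q ^ j) * (q * l / (e * f)) = q * a / f * q ^ j := by field_simp
  have i4 : a * q ^ (2 * j) * (q * l / (e * f)) * q ^ N = g * q ^ j := by
    field_simp; linear_combination -(q ^ j) * hg'
  have i5 : a * q ^ (2 * j) * q ^ (N + 1) = q ^ (j + N + 1) * a * q ^ j := by ring
  have i6 : f * q ^ j * (q * l / (e * f)) = q * l / e * q ^ j := by field_simp
  have i7 : e * q ^ j * (q * l / (e * f)) = q * l / f * q ^ j := by field_simp
  have i8 : a / l * (q * l / (e * f)) = q * a / (e * f) := by field_simp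
  have i9 : q * l / (e * f) = q * a / (e * f) * (l / a) := by field_simp
  have hx' : q * a / (e * f) ≠ 0 := by positivity
  have hl2 : qPoch (l * q ^ (2 * j + 1)) q N ≠ 0 := by
    apply qPoch_shift_ne_zero (n := j + N + 1 + j) (by omega)
    rw [qPoch_add, mul_comm l]
    exact mul_ne_zero h16 (qPoch_ne_zero_of_le (by omega) h14)
  have J := jackson_sum (A := a * q ^ (2 * j)) (B := a / l) (C := e * q ^ j) (D := f * q ^ j)
    (X := q * l / (e * f)) (q := q) (by field_simp; ring) hq0 hq (by positivity) (by positivity)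
    (by positivity) N (by rw [i5]; exact qPoch_shift_ne_zero le_rfl h7) (by rwa [i1])
    (by rw [i2]; exact qPoch_shift_ne_zero le_rfl h4)
    (by rw [i3]; exact qPoch_shift_ne_zero le_rfl h5)
  rw [i1, i2, i3, i4, i5, i6, i7, i8] at J
  have hxN : qPoch (q * l / (e * f)) q N ≠ 0 := qPoch_ne_zero_of_le (by omega) h15
  have key : ∀ r ∈ Finset.range (N + 1), (1 - a * q ^ (2 * (j + r))) *
        (qPoch a q (2 * j + r) * qPoch e q (j + r) * qPoch f q (j + r) * qPoch g q (j + r) *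
          qPoch h q (j + r) * q ^ (j + r) * qPoch (a / l) q r) /
        (qPoch (q * a / e) q (j + r) * qPoch (q * a / f) q (j + r) * qPoch (q * a / g) q (j + r) *
          qPoch (q ^ (j + N + 1) * a) q (j + r) * qPoch q q r * qPoch l q (2 * j + r + 1)) =
      qPoch a q (2 * j) * qPoch e q j * qPoch f q j * qPoch g q j * qPoch h q j * q ^ j *
        qPoch q q N / (qPoch (q * a / e) q j * qPoch (q * a / f) q j * qPoch (q * a / g) q j *
          qPoch (q ^ (j + N + 1) * a) q j * qPoch l q (2 * j + 1) *
          qPoch (q * l / (e * f)) q N) *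
      ((1 - a * q ^ (2 * j) * q ^ (2 * r)) * (qPoch (a * q ^ (2 * j)) q r * qPoch (a / l) q r *
        qPoch (e * q ^ j) q r * qPoch (f * q ^ j) q r * qPoch (g * q ^ j) q r *
          qPoch (q * l / (e * f)) q (N - r) * (q * l / (e * f)) ^ r) /
        (qPoch q q r * qPoch (l * q ^ (2 * j + 1)) q r * qPoch (q * a / e * q ^ j) q r *
          qPoch (q * a / f * q ^ j) q r * qPoch q q (N - r) *
          qPoch (q ^ (j + N + 1) * a * q ^ j) q r)) := by
    intro r hr
    obtain ⟨m, rfl⟩ := Nat.exists_eq_add_of_le' (Nat.lt_succ_iff.mp (Finset.mem_range.mp hr))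
    have reflect := qPoch_reflect_ratio (q := q) (X₁ := q) (X₂ := q * l / (e * f)) (Y₁ := h * q ^ j)
      (Y₂ := q * a / g * q ^ j) hq0 r m
      (by linear_combination q * hh) (by
        field_simp
        linear_combination -hg')
    have hY2 : qPoch (q * a / g * q ^ j) q r ≠ 0 := qPoch_shift_ne_zero (by omega) h6
    have hqm := hq m
    have ratio : qPoch (h * q ^ j) q r * q ^ r / qPoch (q * a / g * q ^ j) q r =
        qPoch q q (m + r) * qPoch (q * l / (e * f)) q m * (q * l / (e * f)) ^ r /
          (qPoch q q m * qPoch (q * l / (e * f)) q (m + r)) := by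
      rw [div_eq_div_iff hY2 (mul_ne_zero hqm hxN)]
      linear_combination reflect
    rw [Nat.add_sub_cancel, show 2 * j + r + 1 = 2 * j + 1 + r by ring]
    simp only [qPoch_add _ _ j r, qPoch_add _ _ (2 * j) r, qPoch_add _ _ (2 * j + 1) r]
    trans (1 - a * q ^ (2 * j) * q ^ (2 * r)) * (qPoch a q (2 * j) * qPoch e q j * qPoch f q j *
      qPoch g q j * qPoch h q j * q ^ j * (qPoch (a * q ^ (2 * j)) q r * qPoch (a / l) q r *
        qPoch (e * q ^ j) q r * qPoch (f * q ^ j) q r * qPoch (g * q ^ j) q r)) /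
        (qPoch (q * a / e) q j * qPoch (q * a / f) q j * qPoch (q * a / g) q j *
          qPoch (q ^ (j + (m + r) + 1) * a) q j * qPoch l q (2 * j + 1) *
          (qPoch q q r * qPoch (l * q ^ (2 * j + 1)) q r * qPoch (q * a / e * q ^ j) q r *
          qPoch (q * a / f * q ^ j) q r * qPoch (q ^ (j + (m + r) + 1) * a * q ^ j) q r)) *
        (qPoch (h * q ^ j) q r * q ^ r / qPoch (q * a / g * q ^ j) q r)
    · rw [div_mul_div_comm]
      congr 1 <;> ring
    · rw [ratio, div_mul_div_comm, div_mul_div_comm]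
      congr 1 <;> ring
  rw [Finset.sum_congr rfl key, ← Finset.mul_sum, J]
  have reflect := qPoch_reflect_ratio (q := q) (X₁ := q * a / (e * f)) (X₂ := q * l / (e * f))
      (Y₁ := q * l / g) (Y₂ := q * a / g) hq0 j N
      (by field_simp; linear_combination -hg') (by field_simp; linear_combination -hg')
  have reflect' : qPoch (q * l / g) q j * qPoch (q * a / (e * f)) q N *
      qPoch (q * l / (e * f)) q (N + j) =
      qPoch (q * a / g) q j * qPoch (q * l / (e * f)) q N * qPoch (q * a / (e * f)) q (N + j) *
        (l / a) ^ j := by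
    apply mul_right_cancel₀ (pow_ne_zero j hx')
    rw [reflect, i9, mul_pow]
    ring
  rw [add_comm N j] at reflect'
  have la : qPoch a q (2 * j) * qPoch (a * q ^ (2 * j)) q (N + 1) =
      qPoch a q (j + N + 1) * qPoch (q ^ (j + N + 1) * a) q j := by
    rw [mul_comm _ a, ← qPoch_add, ← qPoch_add]
    congr 1; ring
  have ll : qPoch l q (2 * j + 1) * qPoch (l * q ^ (2 * j + 1)) q N =
      qPoch l q (j + N + 1) * qPoch (q ^ (j + N + 1) * l) q j := by
    rw [mul_comm _ l, ← qPoch_add, ← qPoch_add]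
    congr 1; ring
  have hY1 : qPoch (q * l / g) q j ≠ 0 := qPoch_ne_zero_of_le (by omega) h13
  have hY2 : qPoch (q * a / g) q j ≠ 0 := qPoch_ne_zero_of_le (by omega) h6
  have ha7 : qPoch (q ^ (j + N + 1) * a) q j ≠ 0 := qPoch_ne_zero_of_le (by omega) h7
  have ratio : qPoch (q * a / (e * f)) q N / (qPoch (q * a / g) q j * qPoch (q * l / (e * f)) q N) =
      qPoch (q * a / (e * f)) q (j + N) * (l / a) ^ j /
        (qPoch (q * l / g) q j * qPoch (q * l / (e * f)) q (j + N)) := by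
    rw [div_eq_div_iff (mul_ne_zero hY2 hxN) (mul_ne_zero hY1 h15)]
    linear_combination reflect'
  rw [qPoch_add (q * l / e), qPoch_add (q * l / f)] at *
  have hN := hq N
  have h11' := left_ne_zero_of_mul h11
  have h12' := left_ne_zero_of_mul h12
  trans (qPoch a q (2 * j) * qPoch (a * q ^ (2 * j)) q (N + 1)) / qPoch (q ^ (j + N + 1) * a) q j *
    (qPoch q q N / qPoch q q N) * (qPoch (q * l / e * q ^ j) q N * qPoch (q * l / f * q ^ j) q N *
      qPoch e q j * qPoch f q j * qPoch g q j * qPoch h q j * q ^ j) /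
    ((qPoch (q * a / e) q j * qPoch (q * a / e * q ^ j) q N) *
      (qPoch (q * a / f) q j * qPoch (q * a / f * q ^ j) q N) *
      (qPoch l q (2 * j + 1) * qPoch (l * q ^ (2 * j + 1)) q N)) *
    (qPoch (q * a / (e * f)) q N / (qPoch (q * a / g) q j * qPoch (q * l / (e * f)) q N))
  · simp only [div_eq_mul_inv, mul_inv]
    ring
  rw [ratio, la, ll, mul_div_cancel_right₀ _ ha7, div_self hN, ← qPoch_add, ← qPoch_add]
  trans qPoch a q (j + N + 1) * (qPoch (q * l / e * q ^ j) q N * qPoch (q * l / f * q ^ j) q N *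
      qPoch e q j * qPoch f q j * qPoch g q j * qPoch h q j * q ^ j) *
      (qPoch (q * a / (e * f)) q (j + N) * (l / a) ^ j) /
    (qPoch (q * a / e) q (j + N) * qPoch (q * a / f) q (j + N) *
      (qPoch l q (j + N + 1) * qPoch (q ^ (j + N + 1) * l) q j) *
      (qPoch (q * l / g) q j * qPoch (q * l / (e * f)) q (j + N))) *
    (qPoch (q * l / e) q j / qPoch (q * l / e) q j) *
    (qPoch (q * l / f) q j / qPoch (q * l / f) q j)
  · rw [div_self h11', div_self h12']
    simp only [div_eq_mul_inv, mul_inv]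
    ring
  · simp only [div_eq_mul_inv, mul_inv]
    ring

/-- Bailey's transformation of a terminating balanced very-well-poised `₁₀W₉`:
with `λ = qa²/(bcd)` and `g = q^{n+2}a³/(bcdef)`,
`₁₀W₉(a; b,c,d,e,f,g,q^{−n}; q, q)
  = [((qa;q)_n (qa/(ef);q)_n ((qa)²/(bcde);q)_n ((qa)²/(bcdf);q)_n)
     / ((qa/e;q)_n (qa/f;q)_n ((qa)²/(bcdef);q)_n ((qa)²/(bcd);q)_n)]
    · ₁₀W₉(λ; qa/(cd), qa/(bd), qa/(bc), e, f, g, q^{−n}; q, q)`,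
both very-well-poised series written out explicitly; `0 < ‖q‖ < 1`, all parameters
nonzero, `a ≠ 1`, `λ ≠ 1`, and no factor in any denominator vanishes. -/
theorem bailey_10W9_transformation (n : ℕ) (q a b c d e f lam g : ℂ)
    (hq0 : 0 < ‖q‖) (hq1 : ‖q‖ < 1)
    (ha : a ≠ 0) (hb : b ≠ 0) (hc : c ≠ 0) (hd : d ≠ 0) (he : e ≠ 0) (hf : f ≠ 0)
    (hlam : lam = q * a ^ 2 / (b * c * d))
    (hg : g = q ^ (n + 2) * a ^ 3 / (b * c * d * e * f))
    (ha1 : a ≠ 1) (hlam1 : lam ≠ 1)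
    (h1 : qPoch (q * a / b) q n ≠ 0) (h2 : qPoch (q * a / c) q n ≠ 0)
    (h3 : qPoch (q * a / d) q n ≠ 0) (h4 : qPoch (q * a / e) q n ≠ 0)
    (h5 : qPoch (q * a / f) q n ≠ 0) (h6 : qPoch (q * a / g) q n ≠ 0)
    (h7 : qPoch (q ^ (n + 1) * a) q n ≠ 0)
    (h8 : qPoch (q * lam / (q * a / (c * d))) q n ≠ 0)
    (h9 : qPoch (q * lam / (q * a / (b * d))) q n ≠ 0)
    (h10 : qPoch (q * lam / (q * a / (b * c))) q n ≠ 0)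
    (h11 : qPoch (q * lam / e) q n ≠ 0) (h12 : qPoch (q * lam / f) q n ≠ 0)
    (h13 : qPoch (q * lam / g) q n ≠ 0) (h14 : qPoch (q ^ (n + 1) * lam) q n ≠ 0)
    (h15 : qPoch ((q * a) ^ 2 / (b * c * d * e * f)) q n ≠ 0)
    (h16 : qPoch ((q * a) ^ 2 / (b * c * d)) q n ≠ 0) :
    ∑ k ∈ Finset.range (n + 1),
        (1 - a * q ^ (2 * k)) / (1 - a) *
          (qPoch a q k * qPoch b q k * qPoch c q k * qPoch d q k * qPoch e q k *
            qPoch f q k * qPoch g q k * qPoch (q ^ (-(n : ℤ))) q k) /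
          (qPoch q q k * qPoch (q * a / b) q k * qPoch (q * a / c) q k *
            qPoch (q * a / d) q k * qPoch (q * a / e) q k * qPoch (q * a / f) q k *
            qPoch (q * a / g) q k * qPoch (q ^ (n + 1) * a) q k) * q ^ k
      = qPoch (q * a) q n * qPoch (q * a / (e * f)) q n *
          qPoch ((q * a) ^ 2 / (b * c * d * e)) q n *
          qPoch ((q * a) ^ 2 / (b * c * d * f)) q n /
          (qPoch (q * a / e) q n * qPoch (q * a / f) q n *
            qPoch ((q * a) ^ 2 / (b * c * d * e * f)) q n *
            qPoch ((q * a) ^ 2 / (b * c * d)) q n) *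
        ∑ k ∈ Finset.range (n + 1),
          (1 - lam * q ^ (2 * k)) / (1 - lam) *
            (qPoch lam q k * qPoch (q * a / (c * d)) q k * qPoch (q * a / (b * d)) q k *
              qPoch (q * a / (b * c)) q k * qPoch e q k * qPoch f q k * qPoch g q k *
              qPoch (q ^ (-(n : ℤ))) q k) /
            (qPoch q q k * qPoch (q * lam / (q * a / (c * d))) q k *
              qPoch (q * lam / (q * a / (b * d))) q k *
              qPoch (q * lam / (q * a / (b * c))) q k * qPoch (q * lam / e) q k *
              qPoch (q * lam / f) q k * qPoch (q * lam / g) q k *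
              qPoch (q ^ (n + 1) * lam) q k) * q ^ k := by
  have hq0' : q ≠ 0 := norm_pos_iff.mp hq0
  have hq := qPoch_self_ne_zero hq1
  have hl : lam ≠ 0 := by rw [hlam]; positivity
  have hg' : g * (e * f) = lam * a * q ^ (n + 1) := by
    rw [hg, hlam]; field_simp; ring
  rw [show (q * a) ^ 2 / (b * c * d * e * f) = q * lam / (e * f) by rw [hlam]; field_simp] at *
  rw [show (q * a) ^ 2 / (b * c * d) = q * lam by rw [hlam]; field_simp] at *
  rw [show (q * a) ^ 2 / (b * c * d * e) = q * lam / e by rw [hlam]; field_simp,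
    show (q * a) ^ 2 / (b * c * d * f) = q * lam / f by rw [hlam]; field_simp,
    show q * lam / (q * a / (c * d)) = q * a / b by rw [hlam]; field_simp,
    show q * lam / (q * a / (b * d)) = q * a / c by rw [hlam]; field_simp,
    show q * lam / (q * a / (b * c)) = q * a / d by rw [hlam]; field_simp]
  have hA : lam * q = q * a / (c * d) * (q * a / (b * d)) * (q * a / (b * c)) * (a / lam) := by
    rw [hlam]; field_simp
  have i1 : q * a / (b * d) * (q * a / (b * c)) * (a / lam) = q * a / b := by
    rw [hlam]; field_simp
  have i2 : q * a / (c * d) * (q * a / (b * c)) * (a / lam) = q * a / c := by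
    rw [hlam]; field_simp
  have i3 : q * a / (c * d) * (q * a / (b * d)) * (a / lam) = q * a / d := by
    rw [hlam]; field_simp
  have i4 : q * a / (b * c) * (a / lam) = d := by rw [hlam]; field_simp
  have i5 : q * a / (c * d) * (a / lam) = b := by rw [hlam]; field_simp
  have i6 : q * a / (b * d) * (a / lam) = c := by rw [hlam]; field_simp
  have i7 : lam * (a / lam) = a := by field_simp
  have hC : q * a / (b * d) ≠ 0 := by positivity
  have hD : q * a / (b * c) ≠ 0 := by positivity
  generalize q * a / (c * d) = B at *
  generalize q * a / (b * d) = C at *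
  generalize q * a / (b * c) = D at *
  have ha1' : 1 - a ≠ 0 := sub_ne_zero.mpr ha1.symm
  have hl1' : 1 - lam ≠ 0 := sub_ne_zero.mpr hlam1.symm
  have sa : qPoch a q (n + 1) = (1 - a) * qPoch (q * a) q n := by
    rw [add_comm, qPoch_add, qPoch_succ, qPoch_zero, pow_zero, pow_one, mul_comm a q]; ring
  have sl : qPoch lam q (n + 1) = (1 - lam) * qPoch (q * lam) q n := by
    rw [add_comm, qPoch_add, qPoch_succ, qPoch_zero, pow_zero, pow_one, mul_comm lam q]; ring
  have hln : qPoch lam q (n + 1) ≠ 0 := by rw [sl]; exact mul_ne_zero hl1' h16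
  have hl2n : qPoch lam q (n + 1 + n) ≠ 0 := by
    rw [qPoch_add, mul_comm lam]; exact mul_ne_zero hln h14
  clear hlam hg
  let P (j : ℕ) : ℂ := (1 - lam * q ^ (2 * j)) *
    (qPoch lam q j * qPoch B q j * qPoch C q j * qPoch D q j * (a / lam) ^ j) /
    ((1 - a) * (qPoch q q j * qPoch (q * a / b) q j * qPoch (q * a / c) q j *
      qPoch (q * a / d) q j))
  let I (j r : ℕ) : ℂ := (1 - a * q ^ (2 * (j + r))) *
        (qPoch a q (2 * j + r) * qPoch e q (j + r) * qPoch f q (j + r) * qPoch g q (j + r) *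
          qPoch (q ^ (-(n : ℤ))) q (j + r) * q ^ (j + r) * qPoch (a / lam) q r) /
        (qPoch (q * a / e) q (j + r) * qPoch (q * a / f) q (j + r) * qPoch (q * a / g) q (j + r) *
          qPoch (q ^ (n + 1) * a) q (j + r) * qPoch q q r * qPoch lam q (2 * j + r + 1))
  trans ∑ m ∈ Finset.range (n + 1), ∑ j ∈ Finset.range (m + 1), P j * I j (m - j)
  · refine Finset.sum_congr rfl fun m hm => ?_
    have hm' : m ≤ n := Nat.lt_succ_iff.mp (Finset.mem_range.mp hm)
    have J := jackson_sum (A := lam) (B := B) (C := C) (D := D) (X := a / lam) hA hq0' hq hC hD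
      (by positivity) m (qPoch_shift_ne_zero (by omega) hl2n)
      (by rw [i1]; exact qPoch_ne_zero_of_le hm' h1)
      (by rw [i2]; exact qPoch_ne_zero_of_le hm' h2)
      (by rw [i3]; exact qPoch_ne_zero_of_le hm' h3)
    rw [i1, i2, i3, i4, i5, i6, i7] at J
    have hlm : qPoch lam q (m + 1) ≠ 0 := qPoch_ne_zero_of_le (by omega) hln
    trans (1 - a * q ^ (2 * m)) * (qPoch a q m * qPoch e q m * qPoch f q m * qPoch g q m *
          qPoch (q ^ (-(n : ℤ))) q m * q ^ m) /
        ((1 - a) * (qPoch (q * a / e) q m * qPoch (q * a / f) q m * qPoch (q * a / g) q m *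
          qPoch (q ^ (n + 1) * a) q m * qPoch lam q (m + 1))) *
        (qPoch lam q (m + 1) * qPoch d q m * qPoch b q m * qPoch c q m /
        (qPoch q q m * qPoch (q * a / b) q m * qPoch (q * a / c) q m * qPoch (q * a / d) q m))
    · refine Eq.trans (mul_one _).symm ?_
      refine Eq.trans (congrArg (_ * ·) (div_self hlm).symm) ?_
      simp only [div_eq_mul_inv, mul_inv]
      ring
    rw [← J, Finset.mul_sum]
    refine Finset.sum_congr rfl fun j hj => ?_
    obtain ⟨r, rfl⟩ := Nat.exists_eq_add_of_le (Nat.lt_succ_iff.mp (Finset.mem_range.mp hj))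
    have ea : qPoch a q (2 * j + r) = qPoch a q (j + r) * qPoch (a * q ^ (j + r)) q j := by
      rw [← qPoch_add]; congr 1; ring
    have el : qPoch lam q (2 * j + r + 1) =
        qPoch lam q (j + r + 1) * qPoch (lam * q ^ (j + r + 1)) q j := by
      rw [← qPoch_add]; congr 1; ring
    simp only [P, I, Nat.add_sub_cancel_left, ea, el, div_mul_div_comm]
    congr 1 <;> ring
  rw [Finset.sum_range_diag_flip (n + 1) fun j r => P j * I j r, Finset.mul_sum]
  refine Finset.sum_congr rfl fun j hj => ?_
  obtain ⟨N, rfl⟩ := Nat.exists_eq_add_of_le (Nat.lt_succ_iff.mp (Finset.mem_range.mp hj))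
  rw [← Finset.mul_sum, show j + N + 1 - j = N + 1 by omega,
    jackson_sum_shifted hq0' hq ha hl he hf j N hg' h4 h5 h6 h7 h11 h12 h13 h14 h15 hln, sa, sl]
  have hr : (a / lam) ^ j * (lam / a) ^ j = 1 := by
    rw [← mul_pow]; field_simp; simp
  have one : (1 : ℂ) = (1 - a) / (1 - a) * ((a / lam) ^ j * (lam / a) ^ j) := by
    rw [div_self ha1', hr, one_mul]
  simp only [P]
  refine Eq.trans ?_ (mul_one _)
  refine Eq.trans ?_ (congrArg (_ * ·) one.symm)
  generalize (a / lam) ^ j = u at *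
  generalize (lam / a) ^ j = v at *
  simp only [div_eq_mul_inv, mul_inv]
  ring
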